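/- In the Marsh–Rietsch setup over ℝ with all parameters t_r > 0: the matrix gᵀ·ẇ admits a UDL factorization gᵀẇ = y₊·y₀·y₋, and for each k ∈ {1,…,n} the k-th diagonal entry of y₀ equals ∏_{r∈J°} t_r^{−([σ_r(i_r) = k] − [σ_r(i_r+1) = k])}, where σ_r := s_{i_m}∘s_{i_{m−1}}∘···∘s_{i_{r+1}} (the empty composition, for r = m, being the identity permutation). In particular, every diagonal entry of y₀ is positive. -/

import Mathlib

open Matrix Finset

namespace Paper

open scoped Classical

noncomputable section

variable {K : Type*} [Field K] {n m : ℕ}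

/-- `N`: upper unitriangular matrices. -/
def IsN (g : Matrix (Fin n) (Fin n) K) : Prop :=
  (∀ i, g i i = 1) ∧ ∀ i j : Fin n, j < i → g i j = 0

/-- `N₋`: lower unitriangular matrices. -/
def IsNm (g : Matrix (Fin n) (Fin n) K) : Prop :=
  (∀ i, g i i = 1) ∧ ∀ i j : Fin n, i < j → g i j = 0

/-- `B`: upper triangular matrices of determinant 1. -/
def IsB (g : Matrix (Fin n) (Fin n) K) : Prop :=
  g.det = 1 ∧ ∀ i j : Fin n, j < i → g i j = 0

/-- `B₋`: lower triangular matrices of determinant 1. -/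
def IsBm (g : Matrix (Fin n) (Fin n) K) : Prop :=
  g.det = 1 ∧ ∀ i j : Fin n, i < j → g i j = 0

/-- `H`: diagonal matrices of determinant 1. -/
def IsH (g : Matrix (Fin n) (Fin n) K) : Prop :=
  g.det = 1 ∧ ∀ i j : Fin n, i ≠ j → g i j = 0

/-- UDL factorization: `g = yp * y0 * ym` with `yp ∈ N`, `y0 ∈ H`, `ym ∈ N₋`. -/
def UDL (g yp y0 ym : Matrix (Fin n) (Fin n) K) : Prop :=
  IsN yp ∧ IsH y0 ∧ IsNm ym ∧ g = yp * y0 * ym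

/-- LDU factorization: `g = zm * z0 * zp` with `zm ∈ N₋`, `z0 ∈ H`, `zp ∈ N`. -/
def LDU (g zm z0 zp : Matrix (Fin n) (Fin n) K) : Prop :=
  IsNm zm ∧ IsH z0 ∧ IsN zp ∧ g = zm * z0 * zp

/-- The signed permutation matrix `v̇`. -/
def pdot (v : Equiv.Perm (Fin n)) : Matrix (Fin n) (Fin n) K :=
  Matrix.of fun a b : Fin n =>
    if a = v b then
      (-1 : K) ^ (univ.filter fun k : Fin n => b < k ∧ v k < v b).card
    else 0

/-- Membership in the double coset `B₋ w B₋`. -/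
def InBmWBm (w : Equiv.Perm (Fin n)) (g : Matrix (Fin n) (Fin n) K) : Prop :=
  ∃ b₁ b₂ : Matrix (Fin n) (Fin n) K, IsBm b₁ ∧ IsBm b₂ ∧ g = b₁ * pdot w * b₂

/-- `Δ^I_J(g)`: the minor with row set `I` and column set `J` (junk value 0 if sizes differ). -/
def minor (g : Matrix (Fin n) (Fin n) K) (I J : Finset (Fin n)) : K :=
  if h : I.card = J.card then
    Matrix.det (Matrix.of fun a b : Fin I.card =>
      g (I.orderEmbOfFin rfl a) (J.orderEmbOfFin h.symm b))
  else 0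

/-- All right-aligned flag minors of `g` are nonnegative. -/
def RightFlagNonneg (g : Matrix (Fin n) (Fin n) ℝ) : Prop :=
  ∀ I : Finset (Fin n),
    0 ≤ minor g I (univ.filter fun j : Fin n => n - I.card ≤ (j : ℕ))

/-- All top-aligned flag minors of `g` are nonnegative. -/
def TopFlagNonneg (g : Matrix (Fin n) (Fin n) ℝ) : Prop :=
  ∀ J : Finset (Fin n),
    0 ≤ minor g (univ.filter fun i : Fin n => (i : ℕ) < J.card) J

/-- `x_i(t)` (with 1-based `i`): `Id + t·E_{i,i+1}`. -/
def xmat (i : ℕ) (t : K) : Matrix (Fin n) (Fin n) K :=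
  Matrix.of fun a b : Fin n =>
    if a = b then 1 else if (a : ℕ) + 1 = i ∧ (b : ℕ) = i then t else 0

/-- `y_i(t)` (with 1-based `i`): `Id + t·E_{i+1,i}`. -/
def ymat (i : ℕ) (t : K) : Matrix (Fin n) (Fin n) K :=
  Matrix.of fun a b : Fin n =>
    if a = b then 1 else if (a : ℕ) = i ∧ (b : ℕ) + 1 = i then t else 0

/-- `ṡ_i` (with 1-based `i`). -/
def sdot (i : ℕ) : Matrix (Fin n) (Fin n) K :=
  Matrix.of fun a b : Fin n =>
    if (a : ℕ) + 1 = i ∧ (b : ℕ) = i then 1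
    else if (a : ℕ) = i ∧ (b : ℕ) + 1 = i then -1
    else if a = b ∧ (a : ℕ) + 1 ≠ i ∧ (a : ℕ) ≠ i then 1
    else 0

/-- The adjacent transposition `s_i` (with 1-based `i`); identity if out of range. -/
def sperm (n : ℕ) (i : ℕ) : Equiv.Perm (Fin n) :=
  if h : i < n then
    Equiv.swap ⟨i - 1, Nat.lt_of_le_of_lt (Nat.sub_le i 1) h⟩ ⟨i, h⟩
  else 1

/-- `ℓ(w)`: the number of inversions of `w`. -/
def len (w : Equiv.Perm (Fin n)) : ℕ :=
  (univ.filter fun p : Fin n × Fin n => p.1 < p.2 ∧ w p.2 < w p.1).card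

/-- `vseq ii v k = v_{(m-k)}`: the rightmost (positive distinguished) subexpression recursion. -/
def vseq (ii : Fin m → ℕ) (v : Equiv.Perm (Fin n)) : ℕ → Equiv.Perm (Fin n)
  | 0 => v
  | k + 1 =>
    if h : m - k - 1 < m then
      if len (vseq ii v k * sperm n (ii ⟨m - k - 1, h⟩)) < len (vseq ii v k) then
        vseq ii v k * sperm n (ii ⟨m - k - 1, h⟩)
      else vseq ii v k
    else vseq ii v k

/-- `r ∈ J°` (0-based `r`, corresponding to the 1-based index `r+1`). -/
def inJ (ii : Fin m → ℕ) (v : Equiv.Perm (Fin n)) (r : Fin m) : Prop :=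
  vseq ii v (m - (r : ℕ)) = vseq ii v (m - (r : ℕ) - 1)

/-- The list `[s_{i_1}, …, s_{i_m}]` of adjacent transpositions. -/
def sPermList (n : ℕ) (ii : Fin m → ℕ) : List (Equiv.Perm (Fin n)) :=
  List.ofFn fun r => sperm n (ii r)

/-- The list `[s^v_{i_1}, …, s^v_{i_m}]`. -/
def svPermList (ii : Fin m → ℕ) (v : Equiv.Perm (Fin n)) : List (Equiv.Perm (Fin n)) :=
  List.ofFn fun r => if inJ ii v r then 1 else sperm n (ii r)

/-- The factors `g_1, …, g_m` of the Marsh–Rietsch element. -/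
def mrgList (ii : Fin m → ℕ) (v : Equiv.Perm (Fin n)) (t : Fin m → K) :
    List (Matrix (Fin n) (Fin n) K) :=
  List.ofFn fun r => if inJ ii v r then xmat (ii r) (t r) else sdot (ii r)

/-- The Marsh–Rietsch element `g = g_1 ⋯ g_m`. -/
def mrg (ii : Fin m → ℕ) (v : Equiv.Perm (Fin n)) (t : Fin m → K) :
    Matrix (Fin n) (Fin n) K :=
  (mrgList ii v t).prod

/-- The list `[ṡ_{i_1}, …, ṡ_{i_m}]`. -/
def sdotList (n : ℕ) (ii : Fin m → ℕ) : List (Matrix (Fin n) (Fin n) K) :=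
  List.ofFn fun r => sdot (ii r)

/-- `ẇ = ṡ_{i_1} ⋯ ṡ_{i_m}`. -/
def wMR (n : ℕ) (ii : Fin m → ℕ) : Matrix (Fin n) (Fin n) K :=
  (sdotList n ii).prod


/-- generalized unipotent -/
def UR (R : Fin n → Fin n → Prop) (l : Matrix (Fin n) (Fin n) K) : Prop :=
  (∀ a, l a a = 1) ∧ ∀ a b, a ≠ b → l a b ≠ 0 → R a b

/-- lower triangular with diagonal d -/
def LT (d : Fin n → K) (b : Matrix (Fin n) (Fin n) K) : Prop :=
  (∀ a, b a a = d a) ∧ ∀ i j : Fin n, i < j → b i j = 0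

/-- the root order attached to w -/
def Rw (w : Equiv.Perm (Fin n)) (a b : Fin n) : Prop := a < b ∧ w b < w a

lemma UR_mul (w : Equiv.Perm (Fin n)) {l l' : Matrix (Fin n) (Fin n) K}
    (h : UR (Rw w) l) (h' : UR (Rw w) l') : UR (Rw w) (l * l') := by
  constructor
  · intro a
    rw [Matrix.mul_apply, Finset.sum_eq_single a]
    · rw [h.1, h'.1, one_mul]
    · intro c _ hc
      by_contra hne
      have h1 := h.2 a c hc.symm (left_ne_zero_of_mul hne)
      have h2 := h'.2 c a hc (right_ne_zero_of_mul hne)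
      exact absurd h1.1 (lt_asymm h2.1)
    · simp
  · intro a b hab hne
    rw [Matrix.mul_apply] at hne
    obtain ⟨c, _, hc⟩ := Finset.exists_ne_zero_of_sum_ne_zero hne
    have n1 := left_ne_zero_of_mul hc
    have n2 := right_ne_zero_of_mul hc
    by_cases hac : a = c
    · subst hac; exact h'.2 a b hab n2
    by_cases hcb : c = b
    · subst hcb; exact h.2 a c hab n1
    have h1 := h.2 a c hac n1
    have h2 := h'.2 c b hcb n2
    exact ⟨h1.1.trans h2.1, h2.2.trans h1.2⟩

lemma LT_mul {d d' : Fin n → K} {l l' : Matrix (Fin n) (Fin n) K}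
    (h : LT d l) (h' : LT d' l') : LT (fun a => d a * d' a) (l * l') := by
  constructor
  · intro a
    rw [Matrix.mul_apply, Finset.sum_eq_single a]
    · rw [h.1, h'.1]
    · intro c _ hc
      rcases lt_or_gt_of_ne hc with h1 | h1
      · rw [h'.2 _ _ h1, mul_zero]
      · rw [h.2 _ _ h1, zero_mul]
    · simp
  · intro a b hab
    rw [Matrix.mul_apply]
    refine Finset.sum_eq_zero fun c _ => ?_
    rcases lt_or_ge a c with h1 | h1
    · rw [h.2 _ _ h1, zero_mul]
    · rw [h'.2 _ _ (lt_of_le_of_lt h1 hab), mul_zero]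

/-- sign of ṡ -/
def ep (q : Fin n) (b : Fin n) : K := if (b : ℕ) + 1 = q then -1 else 1

lemma ep_sq (q b : Fin n) : (ep q b : K) * ep q b = 1 := by
  unfold ep; split_ifs <;> simp

lemma sdot_apply {p q : Fin n} (hpq : (p : ℕ) + 1 = q) (a b : Fin n) :
    (sdot (q : ℕ) : Matrix (Fin n) (Fin n) K) a b =
      if b = Equiv.swap p q a then ep q b else 0 := by
  simp only [sdot, Matrix.of_apply, ep, Equiv.swap_apply_def, Fin.ext_iff]
  grind

lemma mul_sdot_apply {p q : Fin n} (hpq : (p : ℕ) + 1 = q) (A : Matrix (Fin n) (Fin n) K)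
    (a b : Fin n) :
    (A * (sdot (q : ℕ) : Matrix (Fin n) (Fin n) K)) a b = A a (Equiv.swap p q b) * ep q b := by
  rw [Matrix.mul_apply, Finset.sum_eq_single (Equiv.swap p q b)]
  · rw [sdot_apply hpq]; simp
  · intro c _ hc
    rw [sdot_apply hpq, if_neg, mul_zero]
    rintro rfl; simp at hc
  · simp

lemma sdotT_mul_apply {p q : Fin n} (hpq : (p : ℕ) + 1 = q) (A : Matrix (Fin n) (Fin n) K)
    (a b : Fin n) :
    ((sdot (q : ℕ) : Matrix (Fin n) (Fin n) K)ᵀ * A) a b = ep q a * A (Equiv.swap p q a) b := by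
  have := mul_sdot_apply hpq Aᵀ b a
  rw [← Matrix.transpose_apply (_ * _), Matrix.transpose_mul, Matrix.transpose_transpose, this,
    Matrix.transpose_apply, mul_comm]

lemma sdotT_mul {p q : Fin n} (hpq : (p : ℕ) + 1 = q) :
    ((sdot (q : ℕ))ᵀ * sdot (q : ℕ) : Matrix (Fin n) (Fin n) K) = 1 := by
  ext a b
  rw [sdotT_mul_apply hpq, sdot_apply hpq, Equiv.swap_apply_self, Matrix.one_apply]
  by_cases h : a = b
  · subst h; simp [ep_sq]
  · simp [h, Ne.symm h]

lemma sdot_mulT {p q : Fin n} (hpq : (p : ℕ) + 1 = q) :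
    (sdot (q : ℕ) * (sdot (q : ℕ))ᵀ : Matrix (Fin n) (Fin n) K) = 1 :=
  mul_eq_one_comm.mp (sdotT_mul hpq)

lemma mul_y_apply {p q : Fin n} (hpq : (p : ℕ) + 1 = q) (A : Matrix (Fin n) (Fin n) K) (c : K)
    (a b : Fin n) :
    (A * (ymat (q : ℕ) c : Matrix (Fin n) (Fin n) K)) a b = A a b + if b = p then c * A a q else 0 := by
  have : (ymat (q : ℕ) c : Matrix (Fin n) (Fin n) K) = 1 + Matrix.single q p c := by
    ext a b
    simp only [ymat, Matrix.of_apply, Matrix.add_apply, Matrix.one_apply, Matrix.single_apply,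
      Fin.ext_iff]
    grind
  rw [this, mul_add, mul_one, Matrix.add_apply]
  congr 1
  split_ifs with h
  · subst h; simp [mul_comm]
  · rw [Matrix.mul_single_apply_of_ne]; exact h

lemma y_mul_apply {p q : Fin n} (hpq : (p : ℕ) + 1 = q) (A : Matrix (Fin n) (Fin n) K) (c : K)
    (a b : Fin n) :
    ((ymat (q : ℕ) c : Matrix (Fin n) (Fin n) K) * A) a b = A a b + if a = q then c * A p b else 0 := by
  have : (ymat (q : ℕ) c : Matrix (Fin n) (Fin n) K) = 1 + Matrix.single q p c := by
    ext a b
    simp only [ymat, Matrix.of_apply, Matrix.add_apply, Matrix.one_apply, Matrix.single_apply,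
      Fin.ext_iff]
    grind
  rw [this, add_mul, one_mul, Matrix.add_apply]
  congr 1
  split_ifs with h
  · subst h; simp
  · rw [Matrix.single_mul_apply_of_ne]; exact h

/-- torus correction -/
def hh (p q : Fin n) (t : K) (k : Fin n) : K :=
  (if k = p then t⁻¹ else 1) * (if k = q then t else 1)

lemma y_neg {p q : Fin n} (hpq : (p : ℕ) + 1 = q) (c : K) :
    (ymat (q : ℕ) c * ymat (q : ℕ) (-c) : Matrix (Fin n) (Fin n) K) = 1 := by
  have hne : p ≠ q := by intro h; rw [h] at hpq; omega
  ext a b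
  rw [mul_y_apply hpq]
  simp only [ymat, Matrix.of_apply, Matrix.one_apply, Fin.ext_iff]
  grind

lemma x_eq {p q : Fin n} (hpq : (p : ℕ) + 1 = q) {t : K} (ht : t ≠ 0) :
    (xmat (q : ℕ) t : Matrix (Fin n) (Fin n) K) =
      ymat (q : ℕ) t⁻¹ * sdot (q : ℕ) * (Matrix.diagonal (hh p q t) * ymat (q : ℕ) t⁻¹) := by
  ext a b
  rw [← mul_assoc, mul_y_apply hpq, Matrix.mul_diagonal, Matrix.mul_diagonal,
    y_mul_apply hpq, y_mul_apply hpq]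
  simp only [xmat, sdot, hh, Matrix.of_apply, Fin.ext_iff]
  grind

lemma LT_y {p q : Fin n} (hpq : (p : ℕ) + 1 = q) (c : K) :
    LT (fun _ => 1) (ymat (q : ℕ) c : Matrix (Fin n) (Fin n) K) := by
  constructor
  · intro a; simp [ymat]
  · intro i j hij
    simp only [ymat, Matrix.of_apply, Fin.ext_iff]
    have : (i : ℕ) < j := hij
    grind

lemma LT_diag (d : Fin n → K) : LT d (Matrix.diagonal d) := by
  constructor
  · intro a; simp
  · intro i j hij; simp [hij.ne]

/-- the key form -/
def Form (w : Equiv.Perm (Fin n)) (W : Matrix (Fin n) (Fin n) K) (d : Fin n → K)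
    (g : Matrix (Fin n) (Fin n) K) : Prop :=
  ∃ l b, UR (Rw w) l ∧ LT d b ∧ g = W * l * b

lemma swap_lt {p q : Fin n} (hpq : (p : ℕ) + 1 = q) {a b : Fin n} (hab : a < b)
    (h : ¬ (a = p ∧ b = q)) : Equiv.swap p q a < Equiv.swap p q b := by
  simp only [Equiv.swap_apply_def, Fin.lt_def, Fin.ext_iff] at *
  grind

lemma Form_s {p q : Fin n} (hpq : (p : ℕ) + 1 = q) {w : Equiv.Perm (Fin n)}
    (hw : w p < w q) {W : Matrix (Fin n) (Fin n) K} {d : Fin n → K} (hd : ∀ k, d k ≠ 0)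
    {g : Matrix (Fin n) (Fin n) K} (h : Form w W d g) :
    Form (w * Equiv.swap p q) (W * sdot (q : ℕ)) (fun k => d (Equiv.swap p q k))
      (g * sdot (q : ℕ)) := by
  have hne : p ≠ q := by intro h; rw [h] at hpq; omega
  have hlt : p < q := by rw [Fin.lt_def]; omega
  obtain ⟨l, b, hl, hb, rfl⟩ := h
  set S : Matrix (Fin n) (Fin n) K := sdot (q : ℕ) with hS
  set c : K := b q p / d p with hc
  have hY : (ymat (q : ℕ) c * ymat (q : ℕ) (-c) : Matrix (Fin n) (Fin n) K) = 1 := y_neg hpq c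
  have hSS : S * Sᵀ = 1 := sdot_mulT hpq
  refine ⟨(Sᵀ * l * S) * (Sᵀ * (ymat (q : ℕ) c : Matrix (Fin n) (Fin n) K) * S),
    Sᵀ * ((ymat (q : ℕ) (-c) : Matrix (Fin n) (Fin n) K) * b) * S,
    UR_mul _ ⟨?_, ?_⟩ ⟨?_, ?_⟩, ⟨?_, ?_⟩, ?_⟩
  · intro a
    rw [mul_sdot_apply hpq, sdotT_mul_apply hpq, hl.1, mul_one, ep_sq]
  · intro a a' haa' hnz
    rw [mul_sdot_apply hpq, sdotT_mul_apply hpq] at hnz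
    have h0 : l (Equiv.swap p q a) (Equiv.swap p q a') ≠ 0 := by
      intro h; simp [h] at hnz
    have h1 := hl.2 _ _ (by simpa using haa') h0
    refine ⟨?_, h1.2⟩
    have := swap_lt hpq h1.1 (by
      rintro ⟨h2, h3⟩
      have h4 := h1.2
      rw [h2, h3] at h4
      exact lt_asymm h4 hw)
    simpa using this
  · intro a
    rw [mul_sdot_apply hpq, sdotT_mul_apply hpq, (LT_y hpq c).1, mul_one, ep_sq]
  · intro a a' haa' hnz
    rw [mul_sdot_apply hpq, sdotT_mul_apply hpq] at hnz
    have h0 : (ymat (q : ℕ) c : Matrix (Fin n) (Fin n) K)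
      (Equiv.swap p q a) (Equiv.swap p q a') ≠ 0 := by
      intro h; simp [h] at hnz
    have h2 : Equiv.swap p q a = q ∧ Equiv.swap p q a' = p := by
      have h3 : Equiv.swap p q a ≠ Equiv.swap p q a' := by simpa using haa'
      simp only [ymat, Matrix.of_apply, if_neg h3] at h0
      simp only [Fin.ext_iff]
      grind
    have ha : a = p := by
      have := congrArg (Equiv.swap p q) h2.1; simpa using this
    have ha' : a' = q := by
      have := congrArg (Equiv.swap p q) h2.2; simpa using this
    subst ha ha'
    refine ⟨hlt, ?_⟩
    simpa using hw
  · intro a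
    rw [mul_sdot_apply hpq, sdotT_mul_apply hpq, y_mul_apply hpq, hb.1]
    have : (if Equiv.swap p q a = q then -c * b p (Equiv.swap p q a) else 0) = 0 := by
      split_ifs with h
      · rw [h, hb.2 p q hlt, mul_zero]
      · rfl
    rw [this, add_zero, mul_right_comm, ep_sq, one_mul]
  · intro a a' haa'
    rw [mul_sdot_apply hpq, sdotT_mul_apply hpq, y_mul_apply hpq]
    by_cases h : a = p ∧ a' = q
    · obtain ⟨rfl, rfl⟩ := h
      have : b a' a + -c * b a a = 0 := by
        rw [hb.1, hc]; field_simp [hd a]; ring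
      rw [Equiv.swap_apply_left, Equiv.swap_apply_right, if_pos rfl, this, mul_zero, zero_mul]
    · have h1 := swap_lt hpq haa' h
      rw [hb.2 _ _ h1]
      have : (if Equiv.swap p q a = q then -c * b p (Equiv.swap p q a') else 0) = 0 := by
        split_ifs with h2
        · rw [hb.2 p _ (hlt.trans (by rwa [h2] at h1)), mul_zero]
        · rfl
      rw [this, add_zero, mul_zero, zero_mul]
  · calc W * l * b * S = W * 1 * l * 1 * ((ymat (q : ℕ) c : Matrix (Fin n) (Fin n) K) * ymat (q : ℕ) (-c)) * b * S := by
          rw [hY]; simp only [mul_one]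
      _ = W * (S * Sᵀ) * l * (S * Sᵀ) *
          ((ymat (q : ℕ) c : Matrix (Fin n) (Fin n) K) * 1 * ymat (q : ℕ) (-c)) * b * S := by
          rw [hSS, mul_one (ymat (q : ℕ) c)]
      _ = _ := by rw [← hSS]; simp only [mul_assoc]

lemma Form_mul {w : Equiv.Perm (Fin n)} {W : Matrix (Fin n) (Fin n) K} {d d' : Fin n → K}
    {g b : Matrix (Fin n) (Fin n) K} (h : Form w W d g) (hb : LT d' b) :
    Form w W (fun k => d k * d' k) (g * b) := by
  obtain ⟨l, b', hl, hb', rfl⟩ := h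
  exact ⟨l, b' * b, hl, LT_mul hb' hb, by simp only [mul_assoc]⟩

lemma Form_x {p q : Fin n} (hpq : (p : ℕ) + 1 = q) {w : Equiv.Perm (Fin n)}
    (hw : w p < w q) {W : Matrix (Fin n) (Fin n) K} {d : Fin n → K} (hd : ∀ k, d k ≠ 0)
    {g : Matrix (Fin n) (Fin n) K} (h : Form w W d g) {t : K} (ht : t ≠ 0) :
    Form (w * Equiv.swap p q) (W * sdot (q : ℕ)) (fun k => d (Equiv.swap p q k) * hh p q t k)
      (g * xmat (q : ℕ) t) := by
  have h1 := Form_mul h (LT_y hpq t⁻¹)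
  simp only [mul_one] at h1
  have h2 := Form_mul (Form_s hpq hw hd h1) (LT_mul (LT_diag (hh p q t)) (LT_y hpq t⁻¹))
  rw [x_eq hpq ht]
  simpa only [mul_one, mul_assoc] using h2

lemma len_swap {p q : Fin n} (hpq : (p : ℕ) + 1 = q) (w : Equiv.Perm (Fin n)) :
    len (w * Equiv.swap p q) ≤ len w + 1 ∧
      (w q < w p → len (w * Equiv.swap p q) ≤ len w) := by
  have key : ((univ.filter fun x : Fin n × Fin n => x.1 < x.2 ∧
      (w * Equiv.swap p q) x.2 < (w * Equiv.swap p q) x.1).erase (p, q)).card ≤ len w := by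
    unfold len
    refine Finset.card_le_card_of_injOn
      (fun x => (Equiv.swap p q x.1, Equiv.swap p q x.2)) ?_ ?_
    · rintro ⟨a, b⟩ h
      simp only [Finset.coe_erase, Finset.coe_filter, Set.mem_diff, Set.mem_setOf_eq,
        Finset.mem_univ, true_and, Set.mem_singleton_iff, Prod.mk.injEq] at h ⊢
      exact ⟨swap_lt hpq h.1.1 h.2, h.1.2⟩
    · rintro ⟨a, b⟩ _ ⟨a', b'⟩ _ h
      simpa using h
  constructor
  · refine le_trans ?_ (Nat.add_le_add_right key 1)
    have := Finset.pred_card_le_card_erase (s := (univ.filter fun x : Fin n × Fin n => x.1 < x.2 ∧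
      (w * Equiv.swap p q) x.2 < (w * Equiv.swap p q) x.1)) (a := (p, q))
    unfold len
    omega
  · intro h
    rw [Finset.erase_eq_of_notMem] at key
    · exact key
    · intro hm
      have h2 := (Finset.mem_filter.mp hm).2.2
      simp only [Equiv.Perm.mul_apply, Equiv.swap_apply_left, Equiv.swap_apply_right] at h2
      exact lt_asymm h h2

lemma exists_pq {i : ℕ} (h : 1 ≤ i ∧ i < n) :
    ∃ p q : Fin n, (p : ℕ) + 1 = q ∧ i = q ∧ sperm n i = Equiv.swap p q := by
  refine ⟨⟨i - 1, by omega⟩, ⟨i, h.2⟩, by simp; omega, rfl, ?_⟩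
  simp [sperm, h.2]

lemma sPermList_succ (ii : Fin (m + 1) → ℕ) :
    sPermList n ii = sPermList n (fun r => ii r.castSucc) ++ [sperm n (ii (Fin.last m))] := by
  rw [sPermList, List.ofFn_succ', List.concat_eq_append]; rfl

lemma len_prod_le (ii : Fin m → ℕ) (hii : ∀ r, 1 ≤ ii r ∧ ii r < n) :
    len (sPermList n ii).prod ≤ m := by
  induction m with
  | zero =>
    simp only [sPermList, List.ofFn_zero, List.prod_nil, len, Equiv.Perm.coe_one, id]
    rw [Finset.filter_false_of_mem]
    · simp
    · rintro x _ ⟨h1, h2⟩; exact lt_asymm h1 h2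
  | succ m ih =>
    obtain ⟨p, q, hpq, _, hs⟩ := exists_pq (hii (Fin.last m))
    rw [sPermList_succ, List.prod_append, List.prod_singleton, hs]
    exact (len_swap hpq _).1.trans (Nat.add_le_add_right (ih _ fun r => hii _) 1)

/-- exponent -/
def ex (ii : Fin m → ℕ) (r : Fin m) (k : Fin n) : ℤ :=
  (-((if ∃ j : Fin n, (j : ℕ) + 1 = ii r ∧
                      (((sPermList n ii).drop ((r : ℕ) + 1)).reverse.prod) j = k
                  then (1 : ℤ) else 0)
                - (if ∃ j : Fin n, (j : ℕ) = ii r ∧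
                      (((sPermList n ii).drop ((r : ℕ) + 1)).reverse.prod) j = k
                  then (1 : ℤ) else 0)))

/-- the diagonal -/
def DD (ii : Fin m → ℕ) (J : Fin m → Prop) (t : Fin m → K) (k : Fin n) : K :=
  ∏ r ∈ univ.filter (fun r : Fin m => J r), t r ^ ex ii r k

lemma ex_castSucc (ii : Fin (m + 1) → ℕ) (r : Fin m) (k : Fin n) {p q : Fin n}
    (hs : sperm n (ii (Fin.last m)) = Equiv.swap p q) :
    ex ii r.castSucc k = ex (fun r => ii r.castSucc) r (Equiv.swap p q k) := by
  have hlen : (r : ℕ) + 1 ≤ (sPermList n (fun r : Fin m => ii r.castSucc)).length := by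
    simp [sPermList]
  have e : ∀ x y : Fin n, Equiv.swap p q x = y ↔ x = Equiv.swap p q y := by
    intro x y
    rw [Equiv.swap_apply_eq_iff]
  simp only [ex, sPermList_succ, Fin.val_castSucc, List.drop_append_of_le_length hlen,
    List.reverse_append, List.reverse_singleton, List.prod_append, List.prod_singleton, hs,
    Equiv.Perm.mul_apply, e]

lemma ex_last (ii : Fin (m + 1) → ℕ) (k : Fin n) {p q : Fin n} (hpq : (p : ℕ) + 1 = q)
    (hi : ii (Fin.last m) = q) :
    ex ii (Fin.last m) k = -((if k = p then 1 else 0) - (if k = q then 1 else 0)) := by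
  have h0 : (sPermList n ii).drop (m + 1) = [] := by
    apply List.drop_eq_nil_of_le; simp [sPermList]
  have h1 : (∃ j : Fin n, (j : ℕ) + 1 = q ∧ j = k) ↔ k = p := by
    rw [Fin.ext_iff]
    constructor
    · rintro ⟨j, h, rfl⟩; omega
    · intro h; exact ⟨k, by omega, rfl⟩
  have h2 : (∃ j : Fin n, (j : ℕ) = q ∧ j = k) ↔ k = q := by
    rw [Fin.ext_iff]
    constructor
    · rintro ⟨j, h, rfl⟩; exact h
    · intro h; exact ⟨k, h, rfl⟩
  simp only [ex, Fin.val_last, h0, hi, List.reverse_nil, List.prod_nil, Equiv.Perm.coe_one, id,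
    h1, h2]

lemma DD_succ (ii : Fin (m + 1) → ℕ) (J : Fin (m + 1) → Prop) (t : Fin (m + 1) → K) (k : Fin n)
    {p q : Fin n} (hpq : (p : ℕ) + 1 = q) (hi : ii (Fin.last m) = q)
    (hs : sperm n (ii (Fin.last m)) = Equiv.swap p q) :
    DD ii J t k = DD (fun r => ii r.castSucc) (fun r => J r.castSucc) (fun r => t r.castSucc)
      (Equiv.swap p q k) * if J (Fin.last m) then hh p q (t (Fin.last m)) k else 1 := by
  have hne : p ≠ q := by intro h; rw [h] at hpq; omega
  unfold DD
  rw [Finset.prod_filter, Finset.prod_filter, Fin.prod_univ_castSucc]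
  simp only [ex_castSucc ii _ k hs, ex_last ii k hpq hi, hh]
  congr 1
  by_cases hJ : J (Fin.last m) <;> by_cases h1 : k = p <;> by_cases h2 : k = q <;>
    simp_all

lemma prod_hh (p q : Fin n) {t : K} (ht : t ≠ 0) : ∏ k, hh p q t k = 1 := by
  simp only [hh, Finset.prod_mul_distrib, Finset.prod_ite_eq', Finset.mem_univ, if_true]
  exact inv_mul_cancel₀ ht

lemma main_form (ii : Fin m → ℕ) (hii : ∀ r, 1 ≤ ii r ∧ ii r < n)
    (hred : len (sPermList n ii).prod = m) (J : Fin m → Prop) (t : Fin m → K)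
    (ht : ∀ r, J r → t r ≠ 0) :
    Form (sPermList n ii).prod (wMR n ii) (DD ii J t)
      (List.ofFn fun r => if J r then xmat (ii r) (t r) else sdot (ii r)).prod ∧
    (∀ k : Fin n, DD ii J t k ≠ 0) ∧ ∏ k : Fin n, DD ii J t k = 1 ∧
    ((wMR n ii)ᵀ * wMR n ii : Matrix (Fin n) (Fin n) K) = 1 := by
  induction m with
  | zero =>
    refine ⟨⟨1, 1, ⟨by simp, fun a b h => by simp [h]⟩, ⟨by simp [DD], fun a b h => by
      simp [h.ne]⟩, by simp [wMR, sdotList]⟩, by simp [DD], by simp [DD], by simp [wMR, sdotList]⟩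
  | succ m ih =>
    obtain ⟨p, q, hpq, hi, hs⟩ := exists_pq (hii (Fin.last m))
    rw [sPermList_succ, List.prod_append, List.prod_singleton, hs] at hred
    set w' := (sPermList n (fun r : Fin m => ii r.castSucc)).prod with hw'
    have hle : len w' ≤ m := len_prod_le _ fun r => hii _
    have hl := len_swap hpq w'
    have hlt : w' p < w' q := by
      rcases lt_trichotomy (w' p) (w' q) with h | h | h
      · exact h
      · have := w'.injective h
        rw [this] at hpq; omega
      · have := hl.2 h; omega
    obtain ⟨hF, hd, hp, hW⟩ := ih (fun r => ii r.castSucc) (fun r => hii _) (by rw [← hw']; omega)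
      (fun r => J r.castSucc) (fun r => t r.castSucc) (fun r => ht _)
    have hWs : (wMR n ii : Matrix (Fin n) (Fin n) K) =
        wMR n (fun r : Fin m => ii r.castSucc) * sdot (q : ℕ) := by
      rw [wMR, sdotList, List.ofFn_succ', List.concat_eq_append, List.prod_append,
        List.prod_singleton, hi]
      rfl
    have hD : DD ii J t = fun k => DD (fun r => ii r.castSucc) (fun r => J r.castSucc)
      (fun r => t r.castSucc) (Equiv.swap p q k) *
        if J (Fin.last m) then hh p q (t (Fin.last m)) k else 1 := by
      funext k; exact DD_succ ii J t k hpq hi hs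
    rw [sPermList_succ, List.prod_append, List.prod_singleton, hs, ← hw', hWs, hD,
      List.ofFn_succ', List.concat_eq_append, List.prod_append, List.prod_singleton]
    rw [hi]
    refine ⟨?_, ?_, ?_, ?_⟩
    · by_cases hJ : J (Fin.last m)
      · simp only [hJ, if_true]
        exact Form_x hpq hlt hd hF (ht _ hJ)
      · simp only [hJ, if_false, mul_one]
        exact Form_s hpq hlt hd hF
    · intro k
      refine mul_ne_zero (hd _) ?_
      by_cases hJ : J (Fin.last m)
      · have := ht _ hJ
        simp only [hJ, if_true, hh]
        refine mul_ne_zero ?_ ?_ <;> split_ifs <;> simp [this]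
      · simp [hJ]
    · rw [Finset.prod_mul_distrib, Equiv.prod_comp (Equiv.swap p q), hp, one_mul]
      by_cases hJ : J (Fin.last m)
      · simp only [hJ, if_true]
        exact prod_hh p q (ht _ hJ)
      · simp [hJ]
    · rw [Matrix.transpose_mul, mul_assoc, ← mul_assoc _ _ (sdot (q : ℕ)), hW, one_mul,
        sdotT_mul hpq]

lemma UDL_unique {g a b c a' b' c' : Matrix (Fin n) (Fin n) K} (h : UDL g a b c)
    (h' : UDL g a' b' c') (k : Fin n) : b k k = b' k k := by
  obtain ⟨ha, hb, hc, e⟩ := h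
  obtain ⟨ha', hb', hc', e'⟩ := h'
  have hU : ∀ {x : Matrix (Fin n) (Fin n) K}, IsN x → x.BlockTriangular id :=
    fun hx i j hij => hx.2 i j hij
  have hL : ∀ {x : Matrix (Fin n) (Fin n) K}, IsNm x → IsN xᵀ :=
    fun hx => ⟨fun i => hx.1 i, fun i j hij => hx.2 j i hij⟩
  have hdet : ∀ {x : Matrix (Fin n) (Fin n) K}, IsN x → IsUnit x.det := fun hx => by
    rw [Matrix.det_of_upperTriangular (hU hx)]; simp [hx.1]
  have hinv : ∀ {x : Matrix (Fin n) (Fin n) K}, IsN x → IsN x⁻¹ := by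
    intro x hx
    letI := x.invertibleOfIsUnitDet (hdet hx)
    have h1 : x⁻¹.BlockTriangular id := Matrix.blockTriangular_inv_of_blockTriangular (hU hx)
    refine ⟨fun i => ?_, fun i j hij => h1 hij⟩
    have h2 : (x * x⁻¹) i i = 1 := by rw [Matrix.mul_nonsing_inv _ (hdet hx)]; simp
    rw [Matrix.mul_apply, Finset.sum_eq_single i] at h2
    · rwa [hx.1, one_mul] at h2
    · intro j _ hj
      rcases lt_or_gt_of_ne hj with h3 | h3
      · rw [hx.2 _ _ h3, zero_mul]
      · rw [h1 h3, mul_zero]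
    · simp
  -- (a'⁻¹ a) b = b' (c' c⁻¹)
  have hcd : IsUnit c.det := by have := hdet (hL hc); rwa [Matrix.det_transpose] at this
  have hci : IsNm c⁻¹ := by
    have := hinv (hL hc)
    rw [← Matrix.transpose_nonsing_inv] at this
    exact ⟨fun i => this.1 i, fun i j hij => this.2 j i hij⟩
  have key : a'⁻¹ * a * b = b' * (c' * c⁻¹) := by
    calc a'⁻¹ * a * b = a'⁻¹ * (a * b * c) * c⁻¹ := by
          simp only [mul_assoc, Matrix.mul_nonsing_inv _ hcd, mul_one]
      _ = a'⁻¹ * (a' * b' * c') * c⁻¹ := by rw [← e, ← e']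
      _ = (a'⁻¹ * a') * (b' * (c' * c⁻¹)) := by simp only [mul_assoc]
      _ = _ := by rw [Matrix.nonsing_inv_mul _ (hdet ha'), one_mul]
  have hai := hinv ha'
  have d1 : (a'⁻¹ * a) k k = 1 := by
    rw [Matrix.mul_apply, Finset.sum_eq_single k]
    · rw [hai.1, ha.1, one_mul]
    · intro j _ hj
      rcases lt_or_gt_of_ne hj with h3 | h3
      · rw [hai.2 _ _ h3, zero_mul]
      · rw [ha.2 _ _ h3, mul_zero]
    · simp
  have d2 : (c' * c⁻¹) k k = 1 := by
    rw [Matrix.mul_apply, Finset.sum_eq_single k]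
    · rw [hc'.1, hci.1, one_mul]
    · intro j _ hj
      rcases lt_or_gt_of_ne hj with h3 | h3
      · rw [hci.2 _ _ h3, mul_zero]
      · rw [hc'.2 _ _ h3, zero_mul]
    · simp
  have h3 := congrFun (congrFun key k) k
  have h4 : (a'⁻¹ * a * b) k k = b k k := by
    rw [Matrix.mul_apply, Finset.sum_eq_single k, d1, one_mul]
    · intro j _ hj; rw [hb.2 _ _ hj, mul_zero]
    · simp
  have h5 : (b' * (c' * c⁻¹)) k k = b' k k := by
    rw [Matrix.mul_apply, Finset.sum_eq_single k, d2, mul_one]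
    · intro j _ hj; rw [hb'.2 _ _ hj.symm, zero_mul]
    · simp
  rw [← h4, ← h5, h3]

/-- the diagonal factor `y₀` of the UDL factorization of `gᵀẇ`
(Lemma 7.3, type A). Here `σ_r = s_{i_m}∘⋯∘s_{i_{r+1}}`, and the 1-based condition
`σ_r(i_r) = k` is expressed as `∃ j, (j:ℕ)+1 = i_r ∧ σ_r j = k` in 0-based indexing. -/
theorem statement_12 {n m : ℕ} (hn : 1 ≤ n) (ii : Fin m → ℕ)
    (hii : ∀ r, 1 ≤ ii r ∧ ii r < n)
    (w : Equiv.Perm (Fin n)) (hw : w = (sPermList n ii).prod) (hred : len w = m)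
    (v : Equiv.Perm (Fin n)) (hv0 : vseq ii v m = 1)
    (t : Fin m → ℝ) (ht : ∀ r, inJ ii v r → 0 < t r) :
    (∃ a b c, UDL ((mrg ii v t)ᵀ * wMR n ii) a b c) ∧
    ∀ a b c, UDL ((mrg ii v t)ᵀ * wMR n ii) a b c →
      (∀ k : Fin n,
        b k k =
          ∏ r ∈ univ.filter (fun r : Fin m => inJ ii v r),
            t r ^
              (-((if ∃ j : Fin n, (j : ℕ) + 1 = ii r ∧
                      (((sPermList n ii).drop ((r : ℕ) + 1)).reverse.prod) j = k
                  then (1 : ℤ) else 0)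
                - (if ∃ j : Fin n, (j : ℕ) = ii r ∧
                      (((sPermList n ii).drop ((r : ℕ) + 1)).reverse.prod) j = k
                  then (1 : ℤ) else 0)))) ∧
      ∀ k : Fin n, 0 < b k k := by
  subst hw
  obtain ⟨⟨l, b₀, hl, hb, e⟩, hd, hp, hW⟩ := main_form ii hii hred (fun r => inJ ii v r) t
    (fun r hr => (ht r hr).ne')
  set d : Fin n → ℝ := DD ii (fun r => inJ ii v r) t with hdd
  have hU : UDL ((mrg ii v t)ᵀ * wMR n ii) (b₀ᵀ * Matrix.diagonal (fun k => (d k)⁻¹))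
      (Matrix.diagonal d) lᵀ := by
    refine ⟨⟨fun i => ?_, fun i j hij => ?_⟩, ⟨?_, fun i j hij => by simp [hij]⟩,
      ⟨fun i => hl.1 i, fun i j hij => ?_⟩, ?_⟩
    · rw [Matrix.mul_diagonal, Matrix.transpose_apply, hb.1, mul_inv_cancel₀ (hd i)]
    · rw [Matrix.mul_diagonal, Matrix.transpose_apply, hb.2 _ _ hij, zero_mul]
    · rw [Matrix.det_diagonal, hp]
    · by_contra hne
      exact lt_asymm hij (hl.2 j i hij.ne' hne).1
    · have e' : mrg ii v t = wMR n ii * l * b₀ := e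
      have hdiag : Matrix.diagonal (fun k => (d k)⁻¹) * Matrix.diagonal d = 1 := by
        rw [Matrix.diagonal_mul_diagonal, ← Matrix.diagonal_one]
        congr 1; funext k; exact inv_mul_cancel₀ (hd k)
      rw [e', mul_assoc b₀ᵀ, hdiag, mul_one, Matrix.transpose_mul, Matrix.transpose_mul,
        mul_assoc, mul_assoc, hW, mul_one]
  refine ⟨⟨_, _, _, hU⟩, fun a b c h => ?_⟩
  have hb' : ∀ k, b k k = d k := fun k => by rw [UDL_unique h hU k, Matrix.diagonal_apply_eq]
  refine ⟨fun k => hb' k, fun k => ?_⟩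
  rw [hb' k]
  refine Finset.prod_pos fun r hr => zpow_pos (ht r ?_) _
  simpa using hr

end
end Paper
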